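/- Wiener division lemma (local version): let E ⊆ ℝ, ξ ∈ E, and suppose ψ : E → ℂ with ψ(ξ) ≠ 0 agrees on I ∩ E, for some open interval I containing ξ, with the Fourier transform of an integrable function φ ∈ L¹(ℝ). Then there exist an open interval I' containing ξ and g ∈ L¹(ℝ) such that 1/ψ = ĝ on I' ∩ E. -/

import Mathlib

open MeasureTheory

/-- Fourier transform with the paper's normalization `ĝ(x) = ∫ e^{-iπxt} g(t) dt`. -/
noncomputable def paperFT (g : ℝ → ℂ) (x : ℝ) : ℂ :=
  ∫ t : ℝ, Complex.exp (-(Complex.I * (Real.pi : ℂ) * (x : ℂ) * (t : ℂ))) * g t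

open Filter Topology Convolution FourierTransform SchwartzMap

lemma wl_norm_conv (k u : ℝ → ℂ) (hk : Integrable k) (hu : Integrable u) :
    ∫ t, ‖(k ⋆[ContinuousLinearMap.mul ℂ ℂ] u) t‖ ≤ (∫ t, ‖k t‖) * ∫ t, ‖u t‖ := by
  have h := integral_convolution (ContinuousLinearMap.mul ℝ ℝ) hk.norm hu.norm
  simp only [ContinuousLinearMap.mul_apply'] at h
  rw [← h]
  refine integral_mono (hk.integrable_convolution _ hu).norm
    (hk.norm.integrable_convolution _ hu.norm) fun t => ?_
  simp only [convolution_def]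
  refine (norm_integral_le_integral_norm _).trans (le_of_eq ?_)
  simp

lemma wl_neumann (k V : ℝ → ℂ) (hk : Integrable k) (hV : Integrable V)
    (hk1 : ∫ t, ‖k t‖ < 1) (hV0 : 𝓕 V 0 ≠ 0) :
    ∃ g : ℝ → ℂ, Integrable g ∧ ∀ w, (1 - 𝓕 k w) * 𝓕 g w = 𝓕 V w := by
  let u : ℕ → ℝ → ℂ := fun n =>
    Nat.rec V (fun _ v => k ⋆[ContinuousLinearMap.mul ℂ ℂ] v) n
  have hu0 : u 0 = V := rfl
  have hus (n : ℕ) : u (n + 1) = k ⋆[ContinuousLinearMap.mul ℂ ℂ] (u n) := rfl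
  have hui (n : ℕ) : Integrable (u n) := by
    induction n with
    | zero => exact hV
    | succ n ih => rw [hus]; exact hk.integrable_convolution _ ih
  have hk0 : 0 ≤ ∫ t, ‖k t‖ := integral_nonneg fun t => norm_nonneg _
  have hun (n : ℕ) : ∫ t, ‖u n t‖ ≤ (∫ t, ‖k t‖) ^ n * ∫ t, ‖V t‖ := by
    induction n with
    | zero => simp [hu0]
    | succ n ih =>
      rw [hus]
      refine (wl_norm_conv k (u n) hk (hui n)).trans ?_
      rw [pow_succ', mul_assoc]
      gcongr
  have huF (n : ℕ) (w : ℝ) : 𝓕 (u n) w = (𝓕 k w) ^ n * 𝓕 V w := by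
    induction n with
    | zero => simp [hu0]
    | succ n ih =>
      rw [hus, Real.fourier_mul_convolution_eq hk (hui n), ih, pow_succ', mul_assoc]
  have hsum : Summable fun n => ∫ t, ‖u n t‖ :=
    Summable.of_nonneg_of_le (fun n => integral_nonneg fun t => norm_nonneg _) hun
      ((summable_geometric_of_lt_one hk0 hk1).mul_right _)
  have hkF (w : ℝ) : ‖𝓕 k w‖ < 1 := by
    refine lt_of_le_of_lt ?_ hk1
    rw [Real.fourier_real_eq]
    refine (norm_integral_le_integral_norm _).trans (le_of_eq ?_)
    simp
  have key (w : ℝ) : (1 - 𝓕 k w) * 𝓕 (fun t => ∑' n, u n t) w = 𝓕 V w := by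
    have h1 := hasSum_integral_of_summable_integral_norm
      (F := fun n t => Real.fourierChar (-(t * w)) • u n t) (μ := volume)
      (fun n => by
        simpa [mul_comm] using (Real.fourierIntegral_convergent_iff w).2 (hui n))
      (by simpa using hsum)
    have h2 : ∀ n, ∫ t, Real.fourierChar (-(t * w)) • u n t = (𝓕 k w) ^ n * 𝓕 V w := fun n => by
      rw [← huF, Real.fourier_real_eq]
    simp only [h2] at h1
    have h3 : 𝓕 (fun t => ∑' n, u n t) w
        = ∫ t, ∑' n, Real.fourierChar (-(t * w)) • u n t := by
      rw [Real.fourier_real_eq]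
      congr 1
      ext t
      simp only [Circle.smul_def, smul_eq_mul, tsum_mul_left]
    rw [h3, h1.unique ((hasSum_geometric_of_norm_lt_one (hkF w)).mul_right (𝓕 V w)),
      ← mul_assoc, mul_inv_cancel₀, one_mul]
    intro h
    have := hkF w
    rw [← sub_eq_zero.1 h] at this
    simp at this
  refine ⟨_, ?_, key⟩
  by_contra hni
  have h0 := key 0
  rw [Real.fourier_real_eq (fun t => ∑' n, u n t)] at h0
  simp only [mul_zero, neg_zero, AddChar.map_zero_eq_one, one_smul] at h0
  rw [integral_undef hni, mul_zero] at h0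
  exact hV0 h0.symm

lemma wl_bump : ∃ V : 𝓢(ℝ, ℂ), ∀ w : ℝ, |w| ≤ 1 → 𝓕 (V : ℝ → ℂ) w = 1 := by
  let b : ContDiffBump (0 : ℝ) := ⟨1, 2, by norm_num, by norm_num⟩
  have hc : HasCompactSupport (fun x : ℝ => ((b x : ℝ) : ℂ)) :=
    b.hasCompactSupport.comp_left (g := fun x : ℝ => (x : ℂ)) (by simp)
  have hs : ContDiff ℝ (⊤ : ℕ∞) (fun x : ℝ => ((b x : ℝ) : ℂ)) :=
    Complex.ofRealCLM.contDiff.comp b.contDiff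
  let B : 𝓢(ℝ, ℂ) := hc.toSchwartzMap hs
  refine ⟨𝓕⁻ B, fun w hw => ?_⟩
  rw [← SchwartzMap.fourier_coe, FourierTransform.fourier_fourierInv_eq]
  change ((b w : ℝ) : ℂ) = 1
  rw [b.one_of_mem_closedBall (by simpa [b] using hw)]
  simp

lemma wl_omega (V : 𝓢(ℝ, ℂ)) :
    Tendsto (fun τ : ℝ => ∫ t, ‖V t - V (t - τ)‖) (𝓝 0) (𝓝 0) := by
  obtain ⟨C0, -, hC0⟩ := V.decay 0 0
  obtain ⟨C2, -, hC2⟩ := V.decay 2 0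
  have hV : ∀ t, ‖V t‖ ≤ (C0 + C2) * (1 + t ^ 2)⁻¹ := fun t => by
    have h0 := hC0 t
    have h2 := hC2 t
    simp only [norm_iteratedFDeriv_zero, pow_zero, one_mul, Real.norm_eq_abs, sq_abs] at h0 h2
    rw [← div_eq_mul_inv, le_div_iff₀ (by positivity)]
    linarith
  have hC : 0 ≤ C0 + C2 := by
    have := (norm_nonneg _).trans (hV 0)
    simpa using this
  have hlim : (0 : ℝ) = ∫ t, ‖V t - V (t - 0)‖ := by simp
  conv => rhs; rw [hlim]
  refine tendsto_integral_filter_of_dominated_convergence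
    (fun t => 4 * (C0 + C2) * (1 + t ^ 2)⁻¹) ?_ ?_ (integrable_inv_one_add_sq.const_mul _) ?_
  · exact Eventually.of_forall fun τ =>
      (by have := V.continuous; fun_prop : Continuous fun t => ‖V t - V (t - τ)‖).aestronglyMeasurable
  · filter_upwards [Metric.ball_mem_nhds (0 : ℝ) one_pos] with τ hτ
    refine Eventually.of_forall fun t => ?_
    have hτ1 : τ ^ 2 ≤ 1 := by
      rw [sq_le_one_iff_abs_le_one]
      simpa using (mem_ball_zero_iff.1 hτ).le
    have h3 : (1 + (t - τ) ^ 2)⁻¹ ≤ 3 * (1 + t ^ 2)⁻¹ := by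
      rw [← div_eq_mul_inv, inv_eq_one_div, div_le_div_iff₀ (by positivity) (by positivity)]
      nlinarith [sq_nonneg (t - 2 * τ), sq_nonneg (2 * t - 2 * τ - τ)]
    rw [norm_norm]
    calc ‖V t - V (t - τ)‖ ≤ ‖V t‖ + ‖V (t - τ)‖ := norm_sub_le _ _
      _ ≤ (C0 + C2) * (1 + t ^ 2)⁻¹ + (C0 + C2) * (3 * (1 + t ^ 2)⁻¹) :=
        add_le_add (hV t) ((hV _).trans (mul_le_mul_of_nonneg_left h3 hC))
      _ = _ := by ring
  · refine Eventually.of_forall fun t => ?_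
    have : Continuous fun τ => ‖V t - V (t - τ)‖ := by
      have := V.continuous; fun_prop
    exact this.tendsto 0

lemma wl_omega_bound (V : 𝓢(ℝ, ℂ)) (τ : ℝ) :
    ∫ t, ‖V t - V (t - τ)‖ ≤ 2 * ∫ t, ‖V t‖ := by
  have h1 : Integrable (fun t => V (t - τ)) := V.integrable.comp_sub_right τ
  calc ∫ t, ‖V t - V (t - τ)‖ ≤ ∫ t, (‖V t‖ + ‖V (t - τ)‖) :=
        integral_mono (V.integrable.sub h1).norm (V.integrable.norm.add h1.norm)
          fun t => norm_sub_le _ _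
    _ = 2 * ∫ t, ‖V t‖ := by
      rw [integral_add V.integrable.norm h1.norm, integral_sub_right_eq_self (fun t => ‖V t‖)]
      ring

lemma wl_small (V : 𝓢(ℝ, ℂ)) (f : ℝ → ℂ) (hf : Integrable f) :
    Tendsto (fun l : ℝ => ∫ s, ‖f s‖ * ∫ t, ‖V t - V (t - l * s)‖) (𝓝 0) (𝓝 0) := by
  have hlim : (0 : ℝ) = ∫ s, ‖f s‖ * 0 := by simp
  conv => rhs; rw [hlim]
  refine tendsto_integral_filter_of_dominated_convergence
    (fun s => ‖f s‖ * (2 * ∫ t, ‖V t‖)) ?_ ?_ (hf.norm.mul_const _) ?_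
  · refine Eventually.of_forall fun l => hf.norm.aestronglyMeasurable.mul ?_
    have hc : Continuous (fun p : ℝ × ℝ => ‖V p.2 - V (p.2 - l * p.1)‖) := by
      have := V.continuous; fun_prop
    exact (hc.stronglyMeasurable.integral_prod_right (ν := volume)).aestronglyMeasurable
  · refine Eventually.of_forall fun l => Eventually.of_forall fun s => ?_
    rw [norm_mul, norm_norm, Real.norm_of_nonneg (integral_nonneg fun t => norm_nonneg _)]
    exact mul_le_mul_of_nonneg_left (wl_omega_bound V _) (norm_nonneg _)
  · refine Eventually.of_forall fun s => Tendsto.const_mul _ ?_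
    refine (wl_omega V).comp ?_
    have : Continuous fun l : ℝ => l * s := by fun_prop
    simpa using this.tendsto 0

lemma wl_core (V : 𝓢(ℝ, ℂ)) (hV : ∀ w : ℝ, |w| ≤ 1 → 𝓕 (V : ℝ → ℂ) w = 1)
    (F : ℝ → ℂ) (hF : Integrable F) (hc : ∫ s, F s ≠ 0)
    (hs : ∫ s, ‖F s‖ * ∫ t, ‖V t - V (t - s)‖ < ‖∫ s, F s‖) :
    ∃ g : ℝ → ℂ, Integrable g ∧ ∀ w : ℝ, |w| ≤ 1 → 𝓕 F w * 𝓕 g w = 1 := by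
  set c := ∫ s, F s with hcdef
  have hVi : Integrable (V : ℝ → ℂ) := V.integrable
  let q : ℝ → ℂ := F ⋆[ContinuousLinearMap.mul ℂ ℂ] (V : ℝ → ℂ)
  have hq : Integrable q := hF.integrable_convolution _ hVi
  let k : ℝ → ℂ := (V : ℝ → ℂ) - c⁻¹ • q
  have hk : Integrable k := hVi.sub (hq.smul _)
  have hprod1 := hF.convolution_integrand (ContinuousLinearMap.mul ℂ ℂ) hVi
  have hprod2 : Integrable (fun p : ℝ × ℝ => V p.1 * F p.2) (volume.prod volume) :=
    hVi.mul_prod hF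
  have hprod : Integrable (fun p : ℝ × ℝ => F p.2 * (V p.1 - V (p.1 - p.2)))
      (volume.prod volume) := by
    refine (hprod2.sub hprod1).congr (Eventually.of_forall fun p => ?_)
    simp only [Pi.sub_apply, ContinuousLinearMap.mul_apply']
    ring
  have hkeq : ∀ᵐ t, k t = c⁻¹ * ∫ s, F s * (V t - V (t - s)) := by
    filter_upwards [hF.ae_convolution_exists (ContinuousLinearMap.mul ℂ ℂ) hVi] with t ht
    have ht' : Integrable (fun s => F s * V (t - s)) := ht
    simp only [mul_sub]
    rw [integral_sub (hF.mul_const _) ht', integral_mul_const, ← hcdef, mul_sub, ← mul_assoc,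
      inv_mul_cancel₀ hc, one_mul]
    rfl
  have hk1 : ∫ t, ‖k t‖ < 1 := by
    have e1 : ∫ t, ‖k t‖ = ‖c‖⁻¹ * ∫ t, ‖∫ s, F s * (V t - V (t - s))‖ := by
      rw [← integral_const_mul]
      refine integral_congr_ae ?_
      filter_upwards [hkeq] with t ht
      rw [ht, norm_mul, norm_inv]
    have e2 : ∫ t, ‖∫ s, F s * (V t - V (t - s))‖
        ≤ ∫ t, ∫ s, ‖F s * (V t - V (t - s))‖ :=
      integral_mono hprod.integral_prod_left.norm hprod.norm.integral_prod_left
        fun t => norm_integral_le_integral_norm _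
    have e3 : ∫ t, ∫ s, ‖F s * (V t - V (t - s))‖
        = ∫ s, ‖F s‖ * ∫ t, ‖V t - V (t - s)‖ := by
      rw [integral_integral_swap hprod.norm]
      simp only [norm_mul, integral_const_mul]
    rw [e1, inv_mul_lt_iff₀ (norm_pos_iff.2 hc), mul_one]
    linarith
  obtain ⟨g, hg, hgF⟩ := wl_neumann k V hk hVi hk1 (by rw [hV 0 (by simp)]; simp)
  refine ⟨c⁻¹ • g, hg.smul _, fun w hw => ?_⟩
  have hkF : 𝓕 k w = 1 - c⁻¹ * 𝓕 F w := by
    have e : 𝓕 k w = 𝓕 (V : ℝ → ℂ) w - c⁻¹ * 𝓕 q w := by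
      have i1 : Integrable fun v => Real.fourierChar (-(v * w)) • V v := by
        simpa [mul_comm] using (Real.fourierIntegral_convergent_iff w).2 hVi
      have i2 : Integrable fun v => Real.fourierChar (-(v * w)) • q v := by
        simpa [mul_comm] using (Real.fourierIntegral_convergent_iff w).2 hq
      simp only [Real.fourier_real_eq]
      rw [← integral_const_mul, ← integral_sub i1 (i2.const_mul _)]
      congr 1
      ext v
      simp only [k, Pi.sub_apply, Pi.smul_apply, Circle.smul_def, smul_eq_mul]
      ring
    rw [e, Real.fourier_mul_convolution_eq hF hVi, hV w hw, mul_one]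
  have h := hgF w
  rw [hkF, hV w hw] at h
  have e : 𝓕 (c⁻¹ • g) w = c⁻¹ * 𝓕 g w := by
    simp only [Real.fourier_real_eq]
    rw [← integral_const_mul]
    congr 1
    ext v
    simp only [Pi.smul_apply, Circle.smul_def, smul_eq_mul]
    ring
  rw [e, ← h]
  ring

/-- Local Wiener division lemma: if `ψ : E → ℂ` with `ψ(ξ) ≠ 0` agrees on `I ∩ E`, for some
open interval `I ∋ ξ`, with the Fourier transform of `φ ∈ L¹(ℝ)`, then there are an open
interval `I' ∋ ξ` and `g ∈ L¹(ℝ)` with `1/ψ = ĝ` on `I' ∩ E`. -/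
theorem wiener_local_division (E : Set ℝ) (ξ : ℝ) (hξ : ξ ∈ E)
    (ψ : ℝ → ℂ) (hψ : ψ ξ ≠ 0) (a b : ℝ) (ha : a < ξ) (hb : ξ < b)
    (φ : ℝ → ℂ) (hφ : Integrable φ)
    (hagree : ∀ x ∈ Set.Ioo a b ∩ E, ψ x = paperFT φ x) :
    ∃ c d : ℝ, c < ξ ∧ ξ < d ∧
      ∃ g : ℝ → ℂ, Integrable g ∧ ∀ x ∈ Set.Ioo c d ∩ E, (ψ x)⁻¹ = paperFT g x := by
  obtain ⟨V, hV⟩ := wl_bump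
  -- modulated function
  let f : ℝ → ℂ := fun t => Complex.exp (-(Complex.I * (Real.pi : ℂ) * (ξ : ℂ) * (t : ℂ))) * φ t
  have hmod (y : ℝ) (u : ℝ → ℂ) (hu : Integrable u) : Integrable fun t : ℝ =>
      Complex.exp (-(Complex.I * (Real.pi : ℂ) * (y : ℂ) * (t : ℂ))) * u t := by
    refine hu.bdd_mul (c := 1) (Continuous.aestronglyMeasurable (by fun_prop)) ?_
    refine Eventually.of_forall fun t => le_of_eq ?_
    rw [Complex.norm_exp]
    simp
  have hf : Integrable f := hmod ξ φ hφ
  have hc : ∫ s, f s = ψ ξ := (hagree ξ ⟨⟨ha, hb⟩, hξ⟩).symm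
  have hpos : 0 < ‖ψ ξ‖ := norm_pos_iff.2 hψ
  obtain ⟨l, hl0, hl⟩ : ∃ l : ℝ, 0 < l ∧
      ∫ s, ‖f s‖ * ∫ t, ‖V t - V (t - l * s)‖ < ‖ψ ξ‖ := by
    have h1 := ((wl_small V f hf).eventually (gt_mem_nhds hpos)).filter_mono
      (nhdsWithin_le_nhds (s := Set.Ioi 0))
    obtain ⟨l, h, h'⟩ := (h1.and self_mem_nhdsWithin).exists
    exact ⟨l, h', h⟩
  let F : ℝ → ℂ := fun s => (l⁻¹ : ℝ) • f (l⁻¹ * s)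
  have hF : Integrable F := (hf.comp_mul_left' (inv_ne_zero hl0.ne')).smul (l⁻¹ : ℝ)
  have hsub (G : ℝ → ℂ) : ∫ s, (l⁻¹ : ℝ) • G (l⁻¹ * s) = ∫ s, G s := by
    rw [integral_smul, Measure.integral_comp_mul_left G, inv_inv, abs_of_pos hl0, smul_smul,
      inv_mul_cancel₀ hl0.ne', one_smul]
  have hsub' (G : ℝ → ℂ) : ∫ s, (l : ℝ) • G (l * s) = ∫ s, G s := by
    rw [integral_smul, Measure.integral_comp_mul_left G, abs_of_pos (inv_pos.2 hl0), smul_smul,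
      mul_inv_cancel₀ hl0.ne', one_smul]
  have hsubR (G : ℝ → ℝ) : ∫ s, (l⁻¹ : ℝ) • G (l⁻¹ * s) = ∫ s, G s := by
    rw [integral_smul, Measure.integral_comp_mul_left G, inv_inv, abs_of_pos hl0, smul_smul,
      inv_mul_cancel₀ hl0.ne', one_smul]
  have hFint : ∫ s, F s = ψ ξ := by rw [← hc]; exact hsub f
  have hFs : ∫ s, ‖F s‖ * ∫ t, ‖V t - V (t - s)‖ < ‖∫ s, F s‖ := by
    rw [hFint]
    refine lt_of_eq_of_lt ?_ hl
    rw [← hsubR (fun s => ‖f s‖ * ∫ t, ‖V t - V (t - l * s)‖)]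
    congr 1
    ext s
    simp only [F, norm_smul, Real.norm_of_nonneg (inv_pos.2 hl0).le, smul_eq_mul,
      mul_inv_cancel_left₀ hl0.ne', mul_assoc]
  obtain ⟨G, hG, hGF⟩ := wl_core V hV F hF (by rw [hFint]; exact hψ) hFs
  -- relation between transforms, with x = ξ + 2 l w
  have hFF (w : ℝ) : 𝓕 F w = paperFT φ (ξ + 2 * l * w) := by
    rw [Real.fourier_real_eq_integral_exp_smul, paperFT,
      ← hsub (fun t => Complex.exp (-(Complex.I * (Real.pi : ℂ) * ((ξ + 2 * l * w : ℝ) : ℂ) * (t : ℂ))) * φ t)]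
    congr 1
    ext s
    simp only [F, f, smul_eq_mul, Complex.real_smul]
    rw [mul_left_comm, ← mul_assoc (Complex.exp _) (Complex.exp _), ← Complex.exp_add]
    congr 3
    have : (l : ℂ) ≠ 0 := by exact_mod_cast hl0.ne'
    push_cast
    field_simp
    ring
  let g : ℝ → ℂ := fun t =>
    Complex.exp (-(Complex.I * (Real.pi : ℂ) * ((-ξ : ℝ) : ℂ) * (t : ℂ))) * ((l : ℝ) • G (l * t))
  have hg : Integrable g := hmod (-ξ) _ ((hG.comp_mul_left' hl0.ne').smul (l : ℝ))
  have hgF (w : ℝ) : paperFT g (ξ + 2 * l * w) = 𝓕 G w := by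
    rw [Real.fourier_real_eq_integral_exp_smul, paperFT,
      ← hsub' (fun v => Complex.exp (↑(-2 * Real.pi * v * w) * Complex.I) • G v)]
    congr 1
    ext s
    simp only [g, smul_eq_mul, Complex.real_smul]
    rw [← mul_assoc, ← Complex.exp_add, mul_left_comm]
    congr 3
    push_cast
    ring
  refine ⟨max a (ξ - 2 * l), min b (ξ + 2 * l), max_lt ha (by linarith),
    lt_min hb (by linarith), g, hg, ?_⟩
  rintro x ⟨⟨hx1, hx2⟩, hxE⟩
  rw [max_lt_iff] at hx1
  rw [lt_min_iff] at hx2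
  obtain ⟨w, rfl⟩ : ∃ w, x = ξ + 2 * l * w :=
    ⟨(x - ξ) / (2 * l), by field_simp; ring⟩
  have hw : |w| ≤ 1 := by
    rw [abs_le]
    constructor <;> nlinarith
  rw [hagree _ ⟨⟨hx1.1, hx2.1⟩, hxE⟩, ← hFF, hgF]
  exact inv_eq_of_mul_eq_one_right (hGF w hw)
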